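/- arXiv:2512.15272 — 2 statements merged into one kernel-verified Lean document; each statement's English description precedes it below -/
import Mathlib

section
/- In the fused permutations algebra H_{k,n} (k ≥ 1, n ≥ 2), realized as P_k C[S_{k+n}] P_k, set t = P_k + k·(P_k δ_k P_k) and σ_1 = P_k δ_{k+1} P_k = δ_{k+1} P_k. Then (t σ_1)^2 = t(σ_1 t - σ_1 + P_k) and (σ_1 t)^2 = (t σ_1 - σ_1 + P_k) t. In particular t σ_1 t σ_1 - σ_1 t σ_1 t = t σ_1 t - t σ_1 t... i.e., x := t and s := σ_1 satisfy x(s x s + s) = (s x s + s)x. -/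
/-- The symmetrizer `P_k = (1/k!) ∑_{w ∈ S_k} w`, viewed inside the complex group algebra
`ℂ[S_{k+n}]` via the standard inclusion `S_k ⊂ S_{k+n}` (acting on the first `k` letters). -/
noncomputable def symmetrizer (k n : ℕ) : MonoidAlgebra ℂ (Equiv.Perm (Fin (k + n))) :=
  ((k.factorial : ℂ))⁻¹ • ∑ w : Equiv.Perm (Fin k),
    MonoidAlgebra.of ℂ (Equiv.Perm (Fin (k + n)))
      (w.viaEmbedding (Fin.castLEEmb (Nat.le_add_right k n)))

/-- Abstract algebraic core. -/
theorem fused_core {A ι : Type*} [Ring A] [Fintype ι] [DecidableEq ι] (X Y : ι → A) (s P J t σ : A)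
    (hs : s * s = 1) (hXY : ∀ i, X i * Y i = s * X i) (hYX : ∀ i, Y i * X i = X i * s)
    (hc : ∀ i j, i ≠ j → X i * Y j = Y j * X i) (hsX : ∀ i, s * X i * s = Y i)
    (hXs : ∀ i, X i * s * X i = Y i)
    (hP : ∀ i j, i ≠ j → X i * s * X j * P = X j * Y i * P)
    (hsP : s * P = P * s) (hPP : P * P = P) (hJ : J = ∑ i, X i) (hJP : J * P = P * J)
    (ht : t = P + J * P) (hσ : σ = s * P) :
    (t * σ) ^ 2 = t * (σ * t - σ + P) ∧
    (σ * t) ^ 2 = (t * σ - σ + P) * t ∧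
    t * (σ * t * σ + σ) = (σ * t * σ + σ) * t := by
  set K := ∑ i, Y i with hK
  set D := ∑ i, ∑ j, (if i = j then 0 else X i * Y j) with hD
  have hsJs : s * J * s = K := by
    simp only [hJ, hK, Finset.mul_sum, Finset.sum_mul, hsX]
  have h1 : J * K = s * J + D := by
    simp only [hJ, hK, hD, Finset.mul_sum, Finset.sum_mul]
    rw [Finset.sum_comm, ← Finset.sum_add_distrib]
    refine Finset.sum_congr rfl fun i _ => ?_
    have : s * X i = ∑ j, if i = j then s * X i else 0 := by simp
    rw [this, ← Finset.sum_add_distrib]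
    refine Finset.sum_congr rfl fun j _ => ?_
    split_ifs with h
    · subst h; simp [hXY]
    · simp
  have h2 : K * J = J * s + D := by
    simp only [hJ, hK, hD, Finset.mul_sum, Finset.sum_mul]
    rw [← Finset.sum_add_distrib]
    refine Finset.sum_congr rfl fun i _ => ?_
    have : X i * s = ∑ j, if i = j then X i * s else 0 := by simp
    rw [this, ← Finset.sum_add_distrib]
    refine Finset.sum_congr rfl fun j _ => ?_
    split_ifs with h
    · subst h; simp [hYX]
    · simp [hc i j h]
  have h3 : J * s * J * P = K * P + D * P := by
    rw [← add_mul]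
    simp only [hJ, hK, hD, Finset.mul_sum, Finset.sum_mul]
    rw [← Finset.sum_add_distrib, Finset.sum_mul]
    refine Finset.sum_congr rfl fun i _ => ?_
    have : Y i = ∑ j, if i = j then Y i else 0 := by simp
    rw [this, ← Finset.sum_add_distrib, Finset.sum_mul]
    refine Finset.sum_congr rfl fun j _ => ?_
    split_ifs with h
    · subst h; simp [hXs]
    · simp [hP j i (Ne.symm h)]
  -- commuting `P` to the right
  have e1 : P * s = s * P := hsP.symm
  have e2 : P * J = J * P := hJP.symm
  have e1' : ∀ z, P * (s * z) = s * (P * z) := fun z => by rw [← mul_assoc, e1, mul_assoc]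
  have e2' : ∀ z, P * (J * z) = J * (P * z) := fun z => by rw [← mul_assoc, e2, mul_assoc]
  have e3' : ∀ z, P * (P * z) = P * z := fun z => by rw [← mul_assoc, hPP]
  have e4' : ∀ z, s * (s * z) = z := fun z => by rw [← mul_assoc, hs, one_mul]
  have a1 : J * (s * (J * (s * P))) = s * (J * P) + D * P := by
    have := congrArg (· * P) h1
    rw [← hsJs] at this
    simpa only [mul_assoc, add_mul] using this
  have a2 : s * (J * (s * (J * P))) = J * (s * P) + D * P := by
    have := congrArg (· * P) h2
    rw [← hsJs] at this
    simpa only [mul_assoc, add_mul] using this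
  have a3 : J * (s * (J * P)) = s * (J * (s * P)) + D * P := by
    have := h3
    rw [← hsJs] at this
    simpa only [mul_assoc, add_mul] using this
  have r1 : (t * σ) ^ 2 = t * (σ * t - σ + P) := by
    rw [ht, hσ, pow_two]
    simp only [mul_add, add_mul, mul_sub, sub_mul, mul_assoc, e1, e2, e1', e2', e3', e4', hPP, a1, a2, a3]
    abel
  have r2 : (σ * t) ^ 2 = (t * σ - σ + P) * t := by
    rw [ht, hσ, pow_two]
    simp only [mul_add, add_mul, mul_sub, sub_mul, mul_assoc, e1, e2, e1', e2', e3', e4', hPP, a2]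
    simp only [a3]
    abel
  have tP : t * P = t := by rw [ht]; simp only [add_mul, mul_assoc, hPP]
  have Pt : P * t = t := by rw [ht]; simp only [mul_add, e2, e2', hPP]
  refine ⟨r1, r2, ?_⟩
  rw [pow_two] at r1 r2
  have r1' : t * (σ * t * σ) = t * σ * t - t * σ + t := by
    rw [mul_add, mul_sub, tP] at r1; simpa only [mul_assoc] using r1
  have r2' : σ * t * σ * t = t * σ * t - σ * t + t := by
    rw [add_mul, sub_mul, Pt] at r2; simpa only [mul_assoc] using r2
  rw [mul_add, add_mul, r1', r2']; abel

section
open Equiv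

theorem symm_left (k n : ℕ) (v : Perm (Fin k)) :
    MonoidAlgebra.of ℂ (Perm (Fin (k + n))) (v.viaEmbedding (Fin.castLEEmb (Nat.le_add_right k n)))
      * symmetrizer k n = symmetrizer k n := by
  unfold symmetrizer
  rw [mul_smul_comm, Finset.mul_sum]
  congr 1
  simp only [← map_mul]
  refine Fintype.sum_equiv (Equiv.mulLeft v) _ _ fun w => ?_
  congr 1
  exact (map_mul (Perm.viaEmbeddingHom (Fin.castLEEmb (Nat.le_add_right k n))) v w).symm

theorem symm_right (k n : ℕ) (v : Perm (Fin k)) :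
    symmetrizer k n * MonoidAlgebra.of ℂ (Perm (Fin (k + n)))
      (v.viaEmbedding (Fin.castLEEmb (Nat.le_add_right k n))) = symmetrizer k n := by
  unfold symmetrizer
  rw [smul_mul_assoc, Finset.sum_mul]
  congr 1
  simp only [← map_mul]
  refine Fintype.sum_equiv (Equiv.mulRight v) _ _ fun w => ?_
  congr 1
  exact (map_mul (Perm.viaEmbeddingHom (Fin.castLEEmb (Nat.le_add_right k n))) w v).symm

theorem symm_idem (k n : ℕ) : symmetrizer k n * symmetrizer k n = symmetrizer k n := by
  conv_lhs => enter [1]; unfold symmetrizer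
  rw [smul_mul_assoc, Finset.sum_mul]
  simp only [symm_left]
  rw [Finset.sum_const, Finset.card_univ, Fintype.card_perm, Fintype.card_fin,
    ← Nat.cast_smul_eq_nsmul ℂ, smul_smul, inv_mul_cancel₀, one_smul]
  exact_mod_cast k.factorial_ne_zero

theorem symm_comm (k n : ℕ) (x : MonoidAlgebra ℂ (Perm (Fin (k + n))))
    (h : ∀ v : Perm (Fin k), MonoidAlgebra.of ℂ (Perm (Fin (k + n)))
      (v.viaEmbedding (Fin.castLEEmb (Nat.le_add_right k n))) * x = x * MonoidAlgebra.of ℂ _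
      (v.viaEmbedding (Fin.castLEEmb (Nat.le_add_right k n)))) :
    x * symmetrizer k n = symmetrizer k n * x := by
  unfold symmetrizer
  rw [mul_smul_comm, smul_mul_assoc, Finset.sum_mul, Finset.mul_sum]
  simp only [h]

theorem via_swap (k n : ℕ) (i j : Fin k) :
    (swap i j).viaEmbedding (Fin.castLEEmb (Nat.le_add_right k n))
      = swap (Fin.castLE (Nat.le_add_right k n) i) (Fin.castLE (Nat.le_add_right k n) j) := by
  ext x
  by_cases hx : x ∈ Set.range (Fin.castLEEmb (Nat.le_add_right k n))
  · obtain ⟨y, rfl⟩ := hx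
    rw [Perm.viaEmbedding_apply]
    simp only [swap_apply_def, Fin.castLEEmb_apply, Fin.castLE_inj]
    split_ifs <;> rfl
  · rw [Perm.viaEmbedding_apply_of_notMem _ _ _ hx, swap_apply_of_ne_of_ne]
    · rintro rfl; exact hx ⟨i, rfl⟩
    · rintro rfl; exact hx ⟨j, rfl⟩

theorem via_fix (k n : ℕ) (v : Perm (Fin k)) (x : Fin (k + n)) (hx : k ≤ x.val) :
    v.viaEmbedding (Fin.castLEEmb (Nat.le_add_right k n)) x = x := by
  apply Perm.viaEmbedding_apply_of_notMem
  rintro ⟨y, rfl⟩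
  have := y.2
  simp at hx
  omega

theorem via_swap_conj (k n : ℕ) (v : Perm (Fin k)) (x y : Fin (k + n)) :
    v.viaEmbedding (Fin.castLEEmb (Nat.le_add_right k n)) * swap x y =
    swap (v.viaEmbedding (Fin.castLEEmb (Nat.le_add_right k n)) x)
      (v.viaEmbedding (Fin.castLEEmb (Nat.le_add_right k n)) y) *
      v.viaEmbedding (Fin.castLEEmb (Nat.le_add_right k n)) :=
  Equiv.mul_swap_eq_swap_mul _ _ _

theorem sw1 {α : Type*} [DecidableEq α] (i a b : α) (h1 : i ≠ a) (h2 : i ≠ b) (h3 : a ≠ b) :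
    swap i a * swap i b = swap a b * swap i a := by
  ext x; simp only [Perm.mul_apply, swap_apply_def]; grind
theorem sw2 {α : Type*} [DecidableEq α] (i a b : α) (h1 : i ≠ a) (h2 : i ≠ b) (h3 : a ≠ b) :
    swap i b * swap i a = swap i a * swap a b := by
  ext x; simp only [Perm.mul_apply, swap_apply_def]; grind
theorem sw3 {α : Type*} [DecidableEq α] (i j a b : α) (h1 : i ≠ a) (h2 : i ≠ b) (h3 : a ≠ b)
    (h4 : j ≠ a) (h5 : j ≠ b) (h : i ≠ j) :
    swap i a * swap j b = swap j b * swap i a := by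
  ext x; simp only [Perm.mul_apply, swap_apply_def]; grind
theorem sw4 {α : Type*} [DecidableEq α] (i a b : α) (h1 : i ≠ a) (h2 : i ≠ b) (h3 : a ≠ b) :
    swap a b * swap i a * swap a b = swap i b := by
  ext x; simp only [Perm.mul_apply, swap_apply_def]; grind
theorem sw5 {α : Type*} [DecidableEq α] (i a b : α) (h1 : i ≠ a) (h2 : i ≠ b) (h3 : a ≠ b) :
    swap i a * swap a b * swap i a = swap i b := by
  ext x; simp only [Perm.mul_apply, swap_apply_def]; grind
theorem sw6 {α : Type*} [DecidableEq α] (i j a b : α) (h1 : i ≠ a) (h2 : i ≠ b) (h3 : a ≠ b)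
    (h4 : j ≠ a) (h5 : j ≠ b) (h : i ≠ j) :
    swap i a * swap a b * swap j a = swap j a * swap i b * swap i j := by
  ext x; simp only [Perm.mul_apply, swap_apply_def]; grind

end

/-- In `H_{k,n} = P_k ℂ[S_{k+n}] P_k` (with `n ≥ 2`), setting
`t = P_k + k (P_k δ_k P_k)` and `σ₁ = P_k δ_{k+1} P_k`, we have
`(t σ₁)² = t (σ₁ t - σ₁ + P_k)` and `(σ₁ t)² = (t σ₁ - σ₁ + P_k) t`;
in particular `x := t` and `s := σ₁` satisfy `x (s x s + s) = (s x s + s) x`. -/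
theorem t_sigma1_relations (k n : ℕ) (hk : 1 ≤ k) (hn : 2 ≤ n) :
    let P := symmetrizer k n
    let t := P + (k : ℂ) • (P * MonoidAlgebra.of ℂ (Equiv.Perm (Fin (k + n)))
      (Equiv.swap (⟨k - 1, by omega⟩ : Fin (k + n)) ⟨k, by omega⟩) * P)
    let σ₁ := P * MonoidAlgebra.of ℂ (Equiv.Perm (Fin (k + n)))
      (Equiv.swap (⟨k, by omega⟩ : Fin (k + n)) ⟨k + 1, by omega⟩) * P
    (t * σ₁) ^ 2 = t * (σ₁ * t - σ₁ + P) ∧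
    (σ₁ * t) ^ 2 = (t * σ₁ - σ₁ + P) * t ∧
    t * (σ₁ * t * σ₁ + σ₁) = (σ₁ * t * σ₁ + σ₁) * t := by
  intro P t σ₁
  set a : Fin (k + n) := ⟨k, by omega⟩ with ha
  set b : Fin (k + n) := ⟨k + 1, by omega⟩ with hb
  let e : Fin k → Fin (k + n) := Fin.castLE (Nat.le_add_right k n)
  let O := MonoidAlgebra.of ℂ (Equiv.Perm (Fin (k + n)))
  let V : Equiv.Perm (Fin k) → Equiv.Perm (Fin (k + n)) := fun v =>
    v.viaEmbedding (Fin.castLEEmb (Nat.le_add_right k n))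
  have hab : a ≠ b := by simp [ha, hb]
  have hea : ∀ i, e i ≠ a := fun i h => by
    have := congrArg Fin.val h; have := i.2; simp [e, ha] at *; omega
  have heb : ∀ i, e i ≠ b := fun i h => by
    have := congrArg Fin.val h; have := i.2; simp [e, hb] at *; omega
  have he : ∀ i j, i ≠ j → e i ≠ e j := fun i j h h' => h (Fin.castLE_injective _ h')
  have hVa : ∀ v, V v a = a := fun v => via_fix k n v a (by simp [ha])
  have hVb : ∀ v, V v b = b := fun v => via_fix k n v b (by simp [hb])
  have hVe : ∀ v i, V v (e i) = e (v i) := fun v i =>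
    Equiv.Perm.viaEmbedding_apply v (Fin.castLEEmb (Nat.le_add_right k n)) i
  have hl : ∀ v, O (V v) * P = P := symm_left k n
  have hr : ∀ v, P * O (V v) = P := symm_right k n
  have hsP : O (Equiv.swap a b) * P = P * O (Equiv.swap a b) := by
    refine symm_comm k n _ fun v => ?_
    have := via_swap_conj k n v a b
    change V v * _ = Equiv.swap (V v a) (V v b) * V v at this
    rw [hVa, hVb] at this
    change O (V v) * O _ = O _ * O (V v)
    rw [← map_mul, ← map_mul, this]
  have hVX : ∀ v i, O (V v) * O (Equiv.swap (e i) a) = O (Equiv.swap (e (v i)) a) * O (V v) := by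
    intro v i
    have := via_swap_conj k n v (e i) a
    change V v * _ = Equiv.swap (V v (e i)) (V v a) * V v at this
    rw [hVa, hVe] at this
    rw [← map_mul, ← map_mul, this]
  have hJP : (∑ i, O (Equiv.swap (e i) a)) * P = P * ∑ i, O (Equiv.swap (e i) a) := by
    refine symm_comm k n _ fun v => ?_
    change O (V v) * _ = _ * O (V v)
    rw [Finset.mul_sum, Finset.sum_mul]
    exact Fintype.sum_equiv v _ _ fun i => hVX v i
  have hPP : P * P = P := symm_idem k n
  have hsw : ∀ i j, V (Equiv.swap i j) = Equiv.swap (e i) (e j) := via_swap k n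
  have hconj : ∀ i j, P * O (Equiv.swap (e i) a) * P = P * O (Equiv.swap (e j) a) * P := by
    intro i j
    have := hVX (Equiv.swap i j) i
    rw [Equiv.swap_apply_left] at this
    calc P * O (Equiv.swap (e i) a) * P
        = P * O (V (Equiv.swap i j)) * O (Equiv.swap (e i) a) * P := by rw [hr]
      _ = P * O (Equiv.swap (e j) a) * (O (V (Equiv.swap i j)) * P) := by
          rw [mul_assoc P, this]; simp only [mul_assoc]
      _ = _ := by rw [hl]
  have ht : t = P + (∑ i, O (Equiv.swap (e i) a)) * P := by
    change P + (k : ℂ) • (P * O (Equiv.swap (e ⟨k - 1, by omega⟩) a) * P) = _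
    congr 1
    symm
    calc (∑ i, O (Equiv.swap (e i) a)) * P = P * (∑ i, O (Equiv.swap (e i) a)) * P := by
          rw [← hJP, mul_assoc, hPP]
      _ = ∑ i, P * O (Equiv.swap (e i) a) * P := by rw [Finset.mul_sum, Finset.sum_mul]
      _ = ∑ i : Fin k, P * O (Equiv.swap (e ⟨k - 1, by omega⟩) a) * P :=
          Finset.sum_congr rfl fun i _ => hconj i _
      _ = _ := by
          rw [Finset.sum_const, Finset.card_univ, Fintype.card_fin, Nat.cast_smul_eq_nsmul]
  refine fused_core (fun i => O (Equiv.swap (e i) a)) (fun i => O (Equiv.swap (e i) b))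
    (O (Equiv.swap a b)) P _ t σ₁ ?_ ?_ ?_ ?_ ?_ ?_ ?_ hsP hPP rfl hJP ht ?_
  · rw [← map_mul, Equiv.swap_mul_self, map_one]
  · intro i; simp only [← map_mul]; rw [sw1 _ _ _ (hea i) (heb i) hab]
  · intro i; simp only [← map_mul]; rw [sw2 _ _ _ (hea i) (heb i) hab]
  · intro i j h; simp only [← map_mul]
    rw [sw3 _ _ _ _ (hea i) (heb i) hab (hea j) (heb j) (he i j h)]
  · intro i; simp only [← map_mul]; rw [sw4 _ _ _ (hea i) (heb i) hab]
  · intro i; simp only [← map_mul]; rw [sw5 _ _ _ (hea i) (heb i) hab]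
  · intro i j h; simp only [← map_mul]
    rw [sw6 _ _ _ _ (hea i) (heb i) hab (hea j) (heb j) (he i j h), map_mul, mul_assoc,
      ← hsw, hl]
  · change P * O (Equiv.swap a b) * P = _
    rw [← hsP, mul_assoc, hPP]
end

section
/- There is a surjective unital algebra morphism φ from the degenerate cyclotomic affine Hecke algebra Ĥ_n^{(0,k+1)} to the fused permutations algebra H_{k,n} = P_k C[S_{k+n}] P_k, determined by φ(s_i) = δ_{k+i} P_k for i = 1,...,n-1 and φ(x_1) = P_k + k·(P_k δ_k P_k). -/
/-- Generators of the degenerate cyclotomic affine Hecke algebra in its presentation by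
`x₁` and `s₁, …, s_{n-1}`: `Sum.inl ()` is `x₁`, `Sum.inr i` is `s_{i+1}` (0-based). -/
abbrev HeckeGen2 (n : ℕ) := Unit ⊕ Fin (n - 1)

/-- The generator `x₁`. -/
noncomputable def X2 (n : ℕ) : FreeAlgebra ℂ (HeckeGen2 n) :=
  FreeAlgebra.ι ℂ (Sum.inl ())

/-- The generator `s_{i+1}` (0-based index `i`). -/
noncomputable def S2 (n : ℕ) (i : Fin (n - 1)) : FreeAlgebra ℂ (HeckeGen2 n) :=
  FreeAlgebra.ι ℂ (Sum.inr i)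

/-- The defining relations of `Ĥ_n^{(κ₁,κ₂)}` in the presentation with generators `x₁` and
`s₁, …, s_{n-1}`. -/
inductive HeckeRel2 (n : ℕ) (κ₁ κ₂ : ℂ) :
    FreeAlgebra ℂ (HeckeGen2 n) → FreeAlgebra ℂ (HeckeGen2 n) → Prop
  | cyclotomic :
      HeckeRel2 n κ₁ κ₂ ((X2 n - algebraMap ℂ _ κ₁) * (X2 n - algebraMap ℂ _ κ₂)) 0
  | xs_comm (l : Fin (n - 1)) (h : 1 ≤ l.1) :
      HeckeRel2 n κ₁ κ₂ (X2 n * S2 n l) (S2 n l * X2 n)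
  | xsx (h : 0 < n - 1) :
      HeckeRel2 n κ₁ κ₂
        (X2 n * (S2 n ⟨0, h⟩ * X2 n * S2 n ⟨0, h⟩ + S2 n ⟨0, h⟩))
        ((S2 n ⟨0, h⟩ * X2 n * S2 n ⟨0, h⟩ + S2 n ⟨0, h⟩) * X2 n)
  | inv (k : Fin (n - 1)) : HeckeRel2 n κ₁ κ₂ (S2 n k * S2 n k) 1
  | distant (i j : Fin (n - 1)) (h : i.1 + 1 < j.1) :
      HeckeRel2 n κ₁ κ₂ (S2 n i * S2 n j) (S2 n j * S2 n i)
  | braid (k : Fin (n - 1)) (h : k.1 + 1 < n - 1) :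
      HeckeRel2 n κ₁ κ₂ (S2 n k * S2 n ⟨k.1 + 1, h⟩ * S2 n k)
        (S2 n ⟨k.1 + 1, h⟩ * S2 n k * S2 n ⟨k.1 + 1, h⟩)

namespace FusedPerm

theorem descend {F A : Type*} [Ring F] [Algebra ℂ F] [Ring A] [Algebra ℂ A]
    (r : F → F → Prop) (ψ : F →ₐ[ℂ] A) (P : A) (hP : P * P = P)
    (hc : ∀ a, ψ a * P = P * ψ a) (hr : ∀ x y, r x y → ψ x * P = ψ y * P) :
    ∃ φ : RingQuot r →ₗ[ℂ] A, (∀ a b, φ (a * b) = φ a * φ b) ∧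
      ∀ x, φ (RingQuot.mkAlgHom ℂ r x) = ψ x * P := by
  have idem : IsIdempotentElem P := hP
  have key : ∀ a b, ψ a * ψ b * P = (ψ a * P) * (ψ b * P) := by
    intro a b
    rw [hc b, ← mul_assoc, mul_assoc (ψ a) P P, hP, mul_assoc, mul_assoc, hc b]
  let f : F →+* idem.Corner :=
    { toFun := fun a => ⟨ψ a * P, ψ a, by
        show P * ψ a * P = _
        rw [← hc, mul_assoc, hP]⟩
      map_one' := Subtype.ext (by show ψ 1 * P = P; simp)
      map_zero' := Subtype.ext (by show ψ 0 * P = 0; simp)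
      map_add' := fun a b => Subtype.ext (by
        show ψ (a + b) * P = ψ a * P + ψ b * P; simp [add_mul])
      map_mul' := fun a b => Subtype.ext (by
        show ψ (a * b) * P = (ψ a * P) * (ψ b * P); rw [map_mul, key]) }
  have hf : ∀ ⦃x y⦄, r x y → f x = f y := fun x y h => Subtype.ext (hr x y h)
  let g := RingQuot.lift ⟨f, hf⟩
  have hg : ∀ x, (g (RingQuot.mkAlgHom ℂ r x)).1 = ψ x * P := by
    intro x
    have h1 : RingQuot.mkAlgHom ℂ r x = RingQuot.mkRingHom r x := by
      rw [← RingQuot.mkAlgHom_coe ℂ r]; rfl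
    rw [h1]
    have := RingQuot.lift_mkRingHom_apply f hf x
    show (RingQuot.lift ⟨f, hf⟩ (RingQuot.mkRingHom r x)).1 = _
    rw [this]
    rfl
  refine ⟨{ toFun := fun q => (g q).1, map_add' := ?_, map_smul' := ?_ }, ?_, hg⟩
  · intro a b
    rw [map_add]; rfl
  · intro c a
    obtain ⟨x, rfl⟩ := RingQuot.mkAlgHom_surjective ℂ r a
    rw [← map_smul, hg, hg]
    simp
  · intro a b
    show (g (a * b)).1 = (g a).1 * (g b).1
    rw [map_mul]; rfl

variable {k n : ℕ}

/-- Embedding of `S_k`. -/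
noncomputable def eL (k n : ℕ) : Equiv.Perm (Fin k) →* Equiv.Perm (Fin (k + n)) :=
  Equiv.Perm.viaEmbeddingHom (Fin.castLEEmb (Nat.le_add_right k n))

theorem eL_castAdd (u : Equiv.Perm (Fin k)) (i : Fin k) :
    eL k n u (Fin.castAdd n i) = Fin.castAdd n (u i) :=
  Equiv.Perm.viaEmbedding_apply u (Fin.castLEEmb (Nat.le_add_right k n)) i

theorem eL_ge (u : Equiv.Perm (Fin k)) (x : Fin (k + n)) (hx : k ≤ x.1) :
    eL k n u x = x := by
  apply Equiv.Perm.viaEmbedding_apply_of_notMem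
  rintro ⟨i, rfl⟩
  have := i.2
  simp at hx
  omega

theorem exists_via {α β : Type*} [Finite α] (ι : α ↪ β) (g : Equiv.Perm β)
    (hg : ∀ x, x ∉ Set.range ι → g x = x) : ∃ u, Equiv.Perm.viaEmbeddingHom ι u = g := by
  have hmem : ∀ i : α, ∃ j, ι j = g (ι i) := by
    intro i
    by_contra h
    have := g.injective (hg (g (ι i)) h)
    exact h ⟨i, this.symm⟩
  choose f hf using hmem
  have hinj : Function.Injective f := by
    intro i j h
    apply ι.injective
    apply g.injective
    rw [← hf, ← hf, h]
  refine ⟨Equiv.ofBijective f (Finite.injective_iff_bijective.mp hinj), ?_⟩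
  ext x
  rw [Equiv.Perm.viaEmbeddingHom_apply]
  by_cases hx : x ∈ Set.range ι
  · obtain ⟨i, rfl⟩ := hx
    rw [Equiv.Perm.viaEmbedding_apply, ← hf]
    rfl
  · rw [Equiv.Perm.viaEmbedding_apply_of_notMem _ _ _ hx, hg _ hx]

theorem exists_eL (g : Equiv.Perm (Fin (k + n))) (hg : ∀ x, k ≤ x.1 → g x = x) :
    ∃ u, eL k n u = g := by
  apply exists_via
  intro x hx
  apply hg
  by_contra h
  exact hx ⟨⟨x.1, by omega⟩, rfl⟩

/-- the group-like element -/
noncomputable def o (g : Equiv.Perm (Fin (k + n))) : MonoidAlgebra ℂ (Equiv.Perm (Fin (k + n))) :=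
  MonoidAlgebra.of ℂ _ g

theorem o_mul (g h : Equiv.Perm (Fin (k + n))) : o (g * h) = o g * o h := map_mul _ _ _

theorem o_one : o (1 : Equiv.Perm (Fin (k + n))) = 1 := map_one _

theorem symm_eq : symmetrizer k n = ((k.factorial : ℂ))⁻¹ • ∑ w, o (eL k n w) := rfl

theorem absorb_left (g : Equiv.Perm (Fin (k + n))) (hg : ∀ x, k ≤ x.1 → g x = x) :
    o g * symmetrizer k n = symmetrizer k n := by
  obtain ⟨u, rfl⟩ := exists_eL g hg
  rw [symm_eq, mul_smul_comm, Finset.mul_sum]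
  congr 1
  simp_rw [← o_mul, ← map_mul]
  exact Fintype.sum_equiv (Equiv.mulLeft u) _ _ (fun _ => rfl)

theorem absorb_right (g : Equiv.Perm (Fin (k + n))) (hg : ∀ x, k ≤ x.1 → g x = x) :
    symmetrizer k n * o g = symmetrizer k n := by
  obtain ⟨u, rfl⟩ := exists_eL g hg
  rw [symm_eq, smul_mul_assoc, Finset.sum_mul]
  congr 1
  simp_rw [← o_mul, ← map_mul]
  exact Fintype.sum_equiv (Equiv.mulRight u) _ _ (fun _ => rfl)

theorem symm_idem : symmetrizer k n * symmetrizer k n = symmetrizer k n := by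
  conv_lhs => enter [1]; rw [symm_eq]
  rw [smul_mul_assoc, Finset.sum_mul]
  rw [Finset.sum_congr rfl (fun w _ => absorb_left (eL k n w) (eL_ge w))]
  rw [Finset.sum_const, Finset.card_univ, Fintype.card_perm, Fintype.card_fin,
    ← Nat.cast_smul_eq_nsmul ℂ, smul_smul, inv_mul_cancel₀, one_smul]
  exact_mod_cast k.factorial_ne_zero

theorem comm_of (a : MonoidAlgebra ℂ (Equiv.Perm (Fin (k + n))))
    (h : ∀ u, Commute a (o (eL k n u))) : Commute a (symmetrizer k n) := by
  rw [symm_eq]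
  exact Commute.smul_right (Commute.sum_right _ _ _ fun u _ => h u) _

theorem comm_ge (g : Equiv.Perm (Fin (k + n))) (hg : ∀ x, x.1 < k → g x = x) :
    Commute (o g) (symmetrizer k n) := by
  apply comm_of
  intro u
  have : Commute g (eL k n u) := by
    apply Equiv.Perm.Disjoint.commute
    intro x
    by_cases hx : x.1 < k
    · exact Or.inl (hg x hx)
    · exact Or.inr (eL_ge u x (by omega))
  show o g * o _ = o _ * o g
  rw [← o_mul, ← o_mul, this.eq]

/-- partial Jucys-Murphy element -/
noncomputable def L (a : Fin (k + n)) : MonoidAlgebra ℂ (Equiv.Perm (Fin (k + n))) :=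
  ∑ i : Fin k, o (Equiv.swap (Fin.castAdd n i) a)

theorem comm_L (a : Fin (k + n)) (ha : k ≤ a.1) : Commute (L a) (symmetrizer k n) := by
  apply comm_of
  intro u
  show L a * o _ = o _ * L a
  rw [L, Finset.sum_mul, Finset.mul_sum]
  symm
  refine Fintype.sum_equiv u _ _ fun i => ?_
  rw [← o_mul, ← o_mul, Equiv.mul_swap_eq_swap_mul, eL_castAdd, eL_ge u a ha]

theorem conj_L (g : Equiv.Perm (Fin (k + n))) (hg : ∀ x, x.1 < k → g x = x) (a : Fin (k + n)) :
    o g * L a = L (g a) * o g := by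
  rw [L, L, Finset.sum_mul, Finset.mul_sum]
  refine Finset.sum_congr rfl fun i _ => ?_
  rw [← o_mul, ← o_mul, Equiv.mul_swap_eq_swap_mul, hg (Fin.castAdd n i) i.2]

theorem L_sq (a : Fin (k + n)) (ha : k ≤ a.1) :
    L a * (L a * symmetrizer k n) =
      (k : ℂ) • symmetrizer k n + ((k : ℂ) - 1) • (L a * symmetrizer k n) := by
  have h1 : ∀ i j : Fin k, o (Equiv.swap (Fin.castAdd n i) a) *
      (o (Equiv.swap (Fin.castAdd n j) a) * symmetrizer k n) =
      (if i = j then symmetrizer k n - o (Equiv.swap (Fin.castAdd n j) a) * symmetrizer k n else 0)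
        + o (Equiv.swap (Fin.castAdd n j) a) * symmetrizer k n := by
    intro i j
    rw [← mul_assoc, ← o_mul]
    split_ifs with h
    · subst h
      rw [Equiv.swap_mul_self, o_one]; simp
    · have hne : Fin.castAdd n i ≠ Fin.castAdd n j := fun h' => h (Fin.castAdd_injective _ _ h')
      have hia : Fin.castAdd n i ≠ a := fun h' => by
        have := congrArg Fin.val h'; have := i.2; simp at *; omega
      have hja : Fin.castAdd n j ≠ a := fun h' => by
        have := congrArg Fin.val h'; have := j.2; simp at *; omega
      have : Equiv.swap (Fin.castAdd n i) a * Equiv.swap (Fin.castAdd n j) a =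
          Equiv.swap (Fin.castAdd n j) a * Equiv.swap (Fin.castAdd n i) (Fin.castAdd n j) := by
        rw [Equiv.mul_swap_eq_swap_mul (Equiv.swap (Fin.castAdd n j) a)]
        rw [Equiv.swap_apply_of_ne_of_ne hne hia, Equiv.swap_apply_left]
      rw [this, o_mul, mul_assoc, absorb_left, zero_add]
      intro x hx
      apply Equiv.swap_apply_of_ne_of_ne
      · rintro rfl; have := i.2; simp at hx; omega
      · rintro rfl; have := j.2; simp at hx; omega
  have h2 : L a * (L a * symmetrizer k n) = ∑ i : Fin k, ∑ j : Fin k,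
      ((if i = j then symmetrizer k n - o (Equiv.swap (Fin.castAdd n j) a) * symmetrizer k n else 0)
        + o (Equiv.swap (Fin.castAdd n j) a) * symmetrizer k n) := by
    simp only [L, Finset.sum_mul, Finset.mul_sum]
    rw [Finset.sum_comm]
    exact Finset.sum_congr rfl fun i _ => Finset.sum_congr rfl fun j _ => h1 _ _
  rw [h2]
  simp only [Finset.sum_add_distrib, Finset.sum_ite_eq, Finset.mem_univ, if_true,
    Finset.sum_sub_distrib, Finset.sum_const, Finset.card_univ, Fintype.card_fin,
    ← Finset.sum_mul]
  rw [← L, ← Nat.cast_smul_eq_nsmul ℂ, ← Nat.cast_smul_eq_nsmul ℂ, sub_smul, one_smul]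
  abel

/-- L at different places commute -/
theorem comm_L_extra (a b : Fin (k + n)) (ha : k ≤ a.1) (hb : k ≤ b.1) (hab : a ≠ b) :
    Commute (L a) (o (Equiv.swap a b) + L b) := by
  unfold L
  refine Commute.sum_left _ _ _ fun i _ => ?_
  have hia : Fin.castAdd n i ≠ a := fun h' => by
    have := congrArg Fin.val h'; have := i.2; simp at *; omega
  have hib : Fin.castAdd n i ≠ b := fun h' => by
    have := congrArg Fin.val h'; have := i.2; simp at *; omega
  show _ * _ = _ * _
  rw [← Finset.add_sum_erase _ _ (Finset.mem_univ i)]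
  have h3 : ∀ j ∈ Finset.univ.erase i, o (Equiv.swap (Fin.castAdd n i) a) *
      o (Equiv.swap (Fin.castAdd n j) b) = o (Equiv.swap (Fin.castAdd n j) b) *
      o (Equiv.swap (Fin.castAdd n i) a) := by
    intro j hj
    have hj' : j ≠ i := Finset.ne_of_mem_erase hj
    rw [← o_mul, ← o_mul, Equiv.mul_swap_eq_swap_mul, Equiv.swap_apply_of_ne_of_ne _ _,
      Equiv.swap_apply_of_ne_of_ne hib.symm hab.symm]
    · exact fun h => hj' (Fin.castAdd_injective _ _ h)
    · intro h'
      have := congrArg Fin.val h'; have := j.2; simp at *; omega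
  have h1 : o (Equiv.swap (Fin.castAdd n i) a) * o (Equiv.swap a b) =
      o (Equiv.swap (Fin.castAdd n i) b) * o (Equiv.swap (Fin.castAdd n i) a) := by
    rw [← o_mul, ← o_mul, Equiv.mul_swap_eq_swap_mul, Equiv.swap_apply_right,
      Equiv.swap_apply_of_ne_of_ne hib.symm hab.symm]
  have h2 : o (Equiv.swap (Fin.castAdd n i) a) * o (Equiv.swap (Fin.castAdd n i) b) =
      o (Equiv.swap a b) * o (Equiv.swap (Fin.castAdd n i) a) := by
    rw [← o_mul, ← o_mul, Equiv.mul_swap_eq_swap_mul, Equiv.swap_apply_left,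
      Equiv.swap_apply_of_ne_of_ne hib.symm hab.symm]
  rw [mul_add, mul_add, add_mul, add_mul, h1, h2, Finset.mul_sum, Finset.sum_mul,
    Finset.sum_congr rfl h3]
  abel

theorem x_image (b a : Fin (k + n)) (hb : b.1 < k) (ha : k ≤ a.1) :
    (1 + L a) * symmetrizer k n = symmetrizer k n + (k : ℂ) •
      (symmetrizer k n * o (Equiv.swap b a) * symmetrizer k n) := by
  have h : ∀ i : Fin k, symmetrizer k n * (o (Equiv.swap (Fin.castAdd n i) a) * symmetrizer k n) =
      symmetrizer k n * o (Equiv.swap b a) * symmetrizer k n := by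
    intro i
    have hab : a ≠ b := fun h' => by subst h'; omega
    have hia : a ≠ Fin.castAdd n i := fun h' => by
      have := congrArg Fin.val h'; have := i.2; simp at *; omega
    have hfix : ∀ x : Fin (k + n), k ≤ x.1 → Equiv.swap b (Fin.castAdd n i) x = x := by
      intro x hx
      apply Equiv.swap_apply_of_ne_of_ne
      · rintro rfl; omega
      · rintro rfl; have := i.2; simp at hx; omega
    have := Equiv.mul_swap_eq_swap_mul (Equiv.swap b (Fin.castAdd n i)) b a
    rw [Equiv.swap_apply_left, Equiv.swap_apply_of_ne_of_ne hab hia] at this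
    calc _ = symmetrizer k n * (o (Equiv.swap (Fin.castAdd n i) a) *
          (o (Equiv.swap b (Fin.castAdd n i)) * symmetrizer k n)) := by rw [absorb_left _ hfix]
      _ = symmetrizer k n * (o (Equiv.swap b (Fin.castAdd n i)) * o (Equiv.swap b a)
          * symmetrizer k n) := by rw [← mul_assoc (o _) (o _), ← o_mul, ← this, o_mul]
      _ = (symmetrizer k n * o (Equiv.swap b (Fin.castAdd n i))) * o (Equiv.swap b a)
          * symmetrizer k n := by simp only [mul_assoc]
      _ = _ := by rw [absorb_right _ hfix]
  rw [add_mul, one_mul]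
  congr 1
  rw [← symm_idem, ← mul_assoc, (comm_L a ha).eq, symm_idem, mul_assoc, L, Finset.sum_mul,
    Finset.mul_sum, Finset.sum_congr rfl fun i _ => h i]
  rw [Finset.sum_const, Finset.card_univ, Fintype.card_fin, Nat.cast_smul_eq_nsmul]


/-- Embedding of `S_n` acting on the last letters. -/
noncomputable def eR (k n : ℕ) : Equiv.Perm (Fin n) →* Equiv.Perm (Fin (k + n)) :=
  Equiv.Perm.viaEmbeddingHom (Fin.natAddEmb k)

theorem eR_swap (i j : Fin n) :
    eR k n (Equiv.swap i j) = Equiv.swap (Fin.natAdd k i) (Fin.natAdd k j) := by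
  apply Equiv.ext
  intro x
  by_cases hx : x ∈ Set.range (Fin.natAddEmb k : Fin n ↪ Fin (k + n))
  · obtain ⟨l, rfl⟩ := hx
    have h1 : eR k n (Equiv.swap i j) (Fin.natAddEmb k l) = Fin.natAddEmb k (Equiv.swap i j l) :=
      Equiv.Perm.viaEmbedding_apply _ _ _
    rw [h1]
    exact ((Fin.natAddEmb k).injective.swap_apply i j l).symm
  · have h1 : eR k n (Equiv.swap i j) x = x :=
      Equiv.Perm.viaEmbedding_apply_of_notMem _ _ _ hx
    rw [h1, Equiv.swap_apply_of_ne_of_ne]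
    · rintro rfl; exact hx ⟨i, rfl⟩
    · rintro rfl; exact hx ⟨j, rfl⟩

theorem mem_of_fix (S : Subalgebra ℂ (MonoidAlgebra ℂ (Equiv.Perm (Fin (k + n)))))
    (hS : ∀ (i : ℕ) (hi : i + 1 < n),
      o (Equiv.swap (⟨k + i, by omega⟩ : Fin (k + n)) ⟨k + i + 1, by omega⟩) ∈ S)
    (g : Equiv.Perm (Fin (k + n))) (hg : ∀ x, x.1 < k → g x = x) : o g ∈ S := by
  obtain ⟨v, rfl⟩ : ∃ v, eR k n v = g := by
    apply exists_via
    intro x hx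
    apply hg
    by_contra h
    exact hx ⟨⟨x.1 - k, by omega⟩, Fin.ext (by simp; omega)⟩
  clear hg
  cases n with
  | zero =>
    rw [Subsingleton.elim v 1, map_one, o_one]
    exact S.one_mem
  | succ m =>
    have hv : v ∈ Submonoid.closure (Set.range fun i : Fin m ↦ Equiv.swap i.castSucc i.succ) := by
      rw [Equiv.Perm.mclosure_swap_castSucc_succ]; trivial
    induction hv using Submonoid.closure_induction with
    | mem x hx =>
      obtain ⟨i, rfl⟩ := hx
      have := hS i.1 (by omega)
      simp only [eR_swap]
      exact this
    | one => rw [map_one, o_one]; exact S.one_mem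
    | mul x y _ _ hx hy => rw [map_mul, o_mul]; exact S.mul_mem hx hy

theorem L_mem (S : Subalgebra ℂ (MonoidAlgebra ℂ (Equiv.Perm (Fin (k + n)))))
    (hS : ∀ g : Equiv.Perm (Fin (k + n)), (∀ x, x.1 < k → g x = x) → o g ∈ S)
    (c a : Fin (k + n)) (hc : k ≤ c.1) (hL : L c ∈ S) (ha : k ≤ a.1) : L a ∈ S := by
  have hfix : ∀ x : Fin (k + n), x.1 < k → Equiv.swap c a x = x := by
    intro x hx
    apply Equiv.swap_apply_of_ne_of_ne
    · rintro rfl; omega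
    · rintro rfl; omega
  have h := conj_L (Equiv.swap c a) hfix c
  rw [Equiv.swap_apply_left] at h
  have h2 : L a = o (Equiv.swap c a) * L c * o (Equiv.swap c a) := by
    rw [h, mul_assoc, ← o_mul, Equiv.swap_mul_self, o_one, mul_one]
  rw [h2]
  exact S.mul_mem (S.mul_mem (hS _ hfix) hL) (hS _ hfix)

/-- positions below `k` sent above `k` -/
def bad (w : Equiv.Perm (Fin (k + n))) : Finset (Fin (k + n)) :=
  Finset.univ.filter fun x => x.1 < k ∧ k ≤ (w x).1

theorem mem_bad (w : Equiv.Perm (Fin (k + n))) (x) : x ∈ bad w ↔ x.1 < k ∧ k ≤ (w x).1 := by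
  simp [bad]

theorem exists_back (w : Equiv.Perm (Fin (k + n))) (i : Fin (k + n)) (hi : i ∈ bad w) :
    ∃ j : Fin (k + n), k ≤ j.1 ∧ (w j).1 < k := by
  by_contra! h
  rw [mem_bad] at hi
  let s : Finset (Fin (k + n)) := Finset.univ.filter fun x => k ≤ x.1
  have hs : s.image w = s := by
    apply Finset.eq_of_subset_of_card_le
    · intro y hy
      obtain ⟨x, hx, rfl⟩ := Finset.mem_image.mp hy
      simp only [s, Finset.mem_filter, Finset.mem_univ, true_and] at hx ⊢
      exact h x hx
    · rw [Finset.card_image_of_injective _ w.injective]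
  have : w i ∈ s.image w := by
    rw [hs]; simp [s, hi.2]
  obtain ⟨x, hx, hxi⟩ := Finset.mem_image.mp this
  have := w.injective hxi
  subst this
  simp only [s, Finset.mem_filter, Finset.mem_univ, true_and] at hx
  omega

theorem sandwich (u v w : Equiv.Perm (Fin (k + n))) (hu : ∀ x, k ≤ x.1 → u x = x)
    (hv : ∀ x, k ≤ x.1 → v x = x) :
    symmetrizer k n * o (u * w * v) * symmetrizer k n =
      symmetrizer k n * o w * symmetrizer k n := by
  rw [o_mul, o_mul]
  calc _ = (symmetrizer k n * o u) * o w * (o v * symmetrizer k n) := by simp only [mul_assoc]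
    _ = _ := by rw [absorb_left _ hv, absorb_right _ hu]

theorem swap_fix (a b : Fin (k + n)) (ha : a.1 < k) (hb : b.1 < k) (x : Fin (k + n))
    (hx : k ≤ x.1) : Equiv.swap a b x = x := by
  apply Equiv.swap_apply_of_ne_of_ne
  · rintro rfl; omega
  · rintro rfl; omega

theorem mem_main (S : Subalgebra ℂ (MonoidAlgebra ℂ (Equiv.Perm (Fin (k + n)))))
    (T : Submodule ℂ (MonoidAlgebra ℂ (Equiv.Perm (Fin (k + n)))))
    (hST : ∀ s ∈ S, ∀ t ∈ T, s * t ∈ T) (hPT : symmetrizer k n ∈ T)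
    (hS : ∀ g : Equiv.Perm (Fin (k + n)), (∀ x, x.1 < k → g x = x) → o g ∈ S)
    (hL : ∀ a : Fin (k + n), k ≤ a.1 → L a ∈ S) :
    ∀ (m : ℕ) (w : Equiv.Perm (Fin (k + n))), (bad w).card = m →
      symmetrizer k n * o w * symmetrizer k n ∈ T := by
  intro m
  induction m with
  | zero =>
    intro w hw
    have hb : ∀ x : Fin (k + n), x.1 < k → (w x).1 < k := by
      intro x hx
      by_contra h
      have : x ∈ bad w := (mem_bad w x).mpr ⟨hx, by omega⟩
      rw [Finset.card_eq_zero.mp hw] at this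
      simp at this
    let f : Fin k → Fin k := fun i => ⟨(w (Fin.castAdd n i)).1, hb _ i.2⟩
    have hf : Function.Injective f := by
      intro i j h
      have h2 : w (Fin.castAdd n i) = w (Fin.castAdd n j) := by
        apply Fin.ext
        have := congrArg Fin.val h
        exact this
      exact Fin.castAdd_injective _ _ (w.injective h2)
    let u := Equiv.ofBijective f (Finite.injective_iff_bijective.mp hf)
    have hv : ∀ x : Fin (k + n), x.1 < k → ((eL k n u)⁻¹ * w) x = x := by
      intro x hx
      rw [Equiv.Perm.mul_apply, Equiv.Perm.inv_eq_iff_eq]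
      obtain ⟨i, rfl⟩ : ∃ i : Fin k, Fin.castAdd n i = x := ⟨⟨x.1, hx⟩, rfl⟩
      rw [eL_castAdd]
      rfl
    have h1 := sandwich (eL k n u) 1 ((eL k n u)⁻¹ * w) (eL_ge u) (fun _ _ => rfl)
    rw [mul_inv_cancel_left, mul_one] at h1
    rw [h1, ← (comm_ge _ hv).eq, mul_assoc, symm_idem]
    exact hST _ (hS _ hv) _ hPT
  | succ m ih =>
    intro w hw
    obtain ⟨i, hi⟩ : (bad w).Nonempty := by
      rw [← Finset.card_pos]; omega
    obtain ⟨j, hj, hjb⟩ := exists_back w i hi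
    have hi' := (mem_bad w i).mp hi
    obtain ⟨a, ha⟩ : ∃ a, w i = a := ⟨_, rfl⟩
    obtain ⟨b, hb⟩ : ∃ b, w j = b := ⟨_, rfl⟩
    rw [ha] at hi'
    rw [hb] at hjb
    obtain ⟨w', hw'⟩ : ∃ w', w' = Equiv.swap a b * w := ⟨_, rfl⟩
    have hww : w = Equiv.swap b a * w' := by
      rw [hw', Equiv.swap_comm b a, Equiv.swap_mul_self_mul]
    have hw'i : w' i = b := by rw [hw', Equiv.Perm.mul_apply, ha, Equiv.swap_apply_left]
    have hw'j : w' j = a := by rw [hw', Equiv.Perm.mul_apply, hb, Equiv.swap_apply_right]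
    have hbad : bad w' = (bad w).erase i := by
      ext x
      rw [Finset.mem_erase, mem_bad, mem_bad]
      by_cases hxi : x = i
      · subst hxi
        simp only [hw'i]
        constructor
        · rintro ⟨_, h⟩; omega
        · rintro ⟨h, _⟩; exact absurd rfl h
      · by_cases hxj : x = j
        · subst hxj; omega
        · have : w' x = w x := by
            rw [hw', Equiv.Perm.mul_apply, Equiv.swap_apply_of_ne_of_ne]
            · rw [← ha]; exact fun h => hxi (w.injective h)
            · rw [← hb]; exact fun h => hxj (w.injective h)
          rw [this]
          tauto
    have hcard : (bad w').card = m := by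
      rw [hbad, Finset.card_erase_of_mem hi, hw]; rfl
    have hterm1 : ∀ c : Fin k, k ≤ (w'.symm (Fin.castAdd n c)).1 →
        symmetrizer k n * o (Equiv.swap (Fin.castAdd n c) a * w') * symmetrizer k n ∈ T := by
      intro c hc
      apply ih
      rw [← hcard]
      congr 1
      ext x
      rw [mem_bad, mem_bad]
      by_cases hx : x.1 < k
      · have : (Equiv.swap (Fin.castAdd n c) a * w') x = w' x := by
          rw [Equiv.Perm.mul_apply, Equiv.swap_apply_of_ne_of_ne]
          · intro h
            rw [← h, Equiv.symm_apply_apply] at hc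
            omega
          · rw [← hw'j]
            intro h
            have := w'.injective h
            subst this
            omega
        rw [this]
      · tauto
    have hterm2 : ∀ c : Fin k, ¬ k ≤ (w'.symm (Fin.castAdd n c)).1 →
        symmetrizer k n * o (Equiv.swap (Fin.castAdd n c) a * w') * symmetrizer k n =
        symmetrizer k n * o w * symmetrizer k n := by
      intro c hc
      obtain ⟨d, hd⟩ : ∃ d, d = Fin.castAdd n c := ⟨_, rfl⟩
      have hdk : d.1 < k := by rw [hd]; exact c.2
      rw [← hd] at hc ⊢
      rw [← sandwich (Equiv.swap d b) (Equiv.swap i (w'.symm d)) _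
        (swap_fix _ _ hdk hjb) (swap_fix _ _ hi'.1 (by omega))]
      congr 3
      have e1 : w' * Equiv.swap i (w'.symm d) = Equiv.swap b d * w' := by
        rw [Equiv.mul_swap_eq_swap_mul, hw'i, Equiv.apply_symm_apply]
      have e2 : Equiv.swap d b * Equiv.swap d a = Equiv.swap b a * Equiv.swap d b := by
        rw [Equiv.mul_swap_eq_swap_mul, Equiv.swap_apply_left, Equiv.swap_apply_of_ne_of_ne]
        · rintro rfl; omega
        · rintro rfl; omega
      rw [← mul_assoc, mul_assoc _ w', e1, e2, hww, mul_assoc, Equiv.swap_comm b d,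
        Equiv.swap_mul_self_mul]
    have hsum : L a * (symmetrizer k n * o w' * symmetrizer k n) =
        ∑ c : Fin k, symmetrizer k n * o (Equiv.swap (Fin.castAdd n c) a * w')
          * symmetrizer k n := by
      rw [← mul_assoc, ← mul_assoc, (comm_L a hi'.2).eq, L, Finset.mul_sum, Finset.sum_mul,
        Finset.sum_mul]
      refine Finset.sum_congr rfl fun c _ => ?_
      rw [o_mul]
      simp only [mul_assoc]
    have hT : L a * (symmetrizer k n * o w' * symmetrizer k n) ∈ T :=
      hST _ (hL a hi'.2) _ (ih w' hcard)
    rw [hsum, ← Finset.sum_filter_add_sum_filter_not _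
      (fun c : Fin k => k ≤ (w'.symm (Fin.castAdd n c)).1)] at hT
    have hT2 := (Submodule.add_mem_iff_right T (Submodule.sum_mem T fun c hc =>
      hterm1 c (Finset.mem_filter.mp hc).2)).mp hT
    rw [Finset.sum_congr rfl fun c hc => hterm2 c (Finset.mem_filter.mp hc).2, Finset.sum_const,
      ← Nat.cast_smul_eq_nsmul ℂ] at hT2
    refine (Submodule.smul_mem_iff T ?_).mp hT2
    rw [Nat.cast_ne_zero, Finset.card_ne_zero]
    refine ⟨⟨b.1, hjb⟩, Finset.mem_filter.mpr ⟨Finset.mem_univ _, ?_⟩⟩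
    have : Fin.castAdd n (⟨b.1, hjb⟩ : Fin k) = b := rfl
    rw [this, ← hw'i, Equiv.symm_apply_apply]
    omega

end FusedPerm

/-- There is a surjective unital algebra morphism `φ` from `Ĥ_n^{(0,k+1)}` onto the fused
permutations algebra `H_{k,n} = P_k ℂ[S_{k+n}] P_k` (the corner algebra with unit `P_k`, here
realized as the set of `a` with `P_k a P_k = a`), determined by `φ(s_i) = δ_{k+i} P_k` for
`i = 1, …, n-1` and `φ(x₁) = P_k + k · (P_k δ_k P_k)`. -/
theorem hecke_to_fused_permutations (n k : ℕ) (hk : 1 ≤ k) (hn : 1 ≤ n) :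
    ∃ φ : RingQuot (HeckeRel2 n 0 ((k : ℂ) + 1)) →ₗ[ℂ]
        MonoidAlgebra ℂ (Equiv.Perm (Fin (k + n))),
      (∀ a b, φ (a * b) = φ a * φ b) ∧
      φ 1 = symmetrizer k n ∧
      (∀ i : Fin (n - 1),
        φ (RingQuot.mkAlgHom ℂ (HeckeRel2 n 0 ((k : ℂ) + 1)) (S2 n i)) =
          MonoidAlgebra.of ℂ (Equiv.Perm (Fin (k + n)))
              (Equiv.swap (⟨k + i.1, by have := i.isLt; omega⟩ : Fin (k + n))
                ⟨k + i.1 + 1, by have := i.isLt; omega⟩) *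
            symmetrizer k n) ∧
      φ (RingQuot.mkAlgHom ℂ (HeckeRel2 n 0 ((k : ℂ) + 1)) (X2 n)) =
        symmetrizer k n + (k : ℂ) • (symmetrizer k n *
          MonoidAlgebra.of ℂ (Equiv.Perm (Fin (k + n)))
            (Equiv.swap (⟨k - 1, by omega⟩ : Fin (k + n)) ⟨k, by omega⟩) *
          symmetrizer k n) ∧
      Set.range φ = {a | symmetrizer k n * a * symmetrizer k n = a} := by
  classical
  let P := symmetrizer k n
  let kk : Fin (k + n) := ⟨k, by omega⟩
  let sw : Fin (n - 1) → Equiv.Perm (Fin (k + n)) := fun i =>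
    Equiv.swap (⟨k + i.1, by have := i.isLt; omega⟩ : Fin (k + n))
                ⟨k + i.1 + 1, by have := i.isLt; omega⟩
  let ψ : FreeAlgebra ℂ (HeckeGen2 n) →ₐ[ℂ] MonoidAlgebra ℂ (Equiv.Perm (Fin (k + n))) :=
    FreeAlgebra.lift ℂ (Sum.elim (fun _ => 1 + FusedPerm.L kk) (fun i => FusedPerm.o (sw i)))
  have hX : ψ (X2 n) = 1 + FusedPerm.L kk := by
    simp only [ψ, X2, FreeAlgebra.lift_ι_apply, Sum.elim_inl]
  have hSi : ∀ i, ψ (S2 n i) = FusedPerm.o (sw i) := by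
    intro i
    simp only [ψ, S2, FreeAlgebra.lift_ι_apply, Sum.elim_inr]
  have hfix : ∀ i (x : Fin (k + n)), x.1 < k → sw i x = x := by
    intro i x hx
    apply Equiv.swap_apply_of_ne_of_ne
    · rintro rfl; simp at hx
    · rintro rfl; simp at hx; omega
  have hkk : k ≤ kk.1 := le_refl k
  have hsq : ∀ i, FusedPerm.o (sw i) * FusedPerm.o (sw i) = 1 := by
    intro i
    rw [← FusedPerm.o_mul, Equiv.swap_mul_self, FusedPerm.o_one]
  have hc : ∀ a, ψ a * P = P * ψ a := by
    intro a
    induction a using FreeAlgebra.induction with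
    | grade0 r => rw [AlgHom.commutes]; exact Algebra.commutes r P
    | grade1 x =>
      rcases x with ⟨⟩ | i
      · have := hX
        unfold X2 at this
        rw [this]
        exact ((Commute.one_left _).add_left (FusedPerm.comm_L kk hkk)).eq
      · have := hSi i
        unfold S2 at this
        rw [this]
        exact (FusedPerm.comm_ge _ (hfix i)).eq
    | mul a b ha hb => rw [map_mul, mul_assoc, hb, ← mul_assoc, ha, mul_assoc]
    | add a b ha hb => rw [map_add, add_mul, mul_add, ha, hb]
  have hP : P * P = P := FusedPerm.symm_idem
  obtain ⟨φ, hmul, hφ⟩ := FusedPerm.descend (HeckeRel2 n 0 ((k : ℂ) + 1)) ψ P hP hc (by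
    intro x y hxy
    cases hxy with
    | cyclotomic =>
      have h := FusedPerm.L_sq kk hkk
      simp only [map_mul, map_sub, hX, AlgHom.commutes, map_zero, sub_zero, zero_mul]
      rw [mul_assoc, sub_mul, ← Algebra.smul_def]
      simp only [add_mul, mul_sub, mul_add, one_mul, mul_smul_comm]
      change FusedPerm.L kk * (FusedPerm.L kk * P) =
        (k : ℂ) • P + ((k : ℂ) - 1) • (FusedPerm.L kk * P) at h
      rw [h]
      module
    | xs_comm l h =>
      congr 1
      rw [map_mul, map_mul, hX, hSi, mul_add, add_mul, FusedPerm.conj_L _ (hfix l)]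
      have : sw l kk = kk := by
        apply Equiv.swap_apply_of_ne_of_ne
        · intro h'; have := congrArg Fin.val h'; simp [kk] at this; omega
        · intro h'; have := congrArg Fin.val h'; simp [kk] at this; omega
      rw [this, one_mul, mul_one]
    | xsx h =>
      congr 1
      have h0 : sw ⟨0, h⟩ = Equiv.swap kk ⟨k + 1, by omega⟩ := rfl
      have h1 := FusedPerm.conj_L _ (hfix ⟨0, h⟩) kk
      have h2 := FusedPerm.comm_L_extra kk ⟨k + 1, by omega⟩ hkk (by simp)
        (by intro h'; have := congrArg Fin.val h'; simp [kk] at this)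
      rw [← h0] at h2
      have h3 : sw ⟨0, h⟩ kk = ⟨k + 1, by omega⟩ := by rw [h0, Equiv.swap_apply_left]
      rw [h3] at h1
      have h4 : FusedPerm.o (sw ⟨0, h⟩) * (1 + FusedPerm.L kk) * FusedPerm.o (sw ⟨0, h⟩) +
          FusedPerm.o (sw ⟨0, h⟩) =
          1 + (FusedPerm.o (sw ⟨0, h⟩) + FusedPerm.L ⟨k + 1, by omega⟩) := by
        rw [mul_add, mul_one, add_mul, hsq, h1, mul_assoc, hsq, mul_one]
        abel
      simp only [map_mul, map_add, hX, hSi]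
      rw [h4]
      exact ((Commute.one_left _).add_left ((Commute.one_right _).add_right h2)).eq
    | inv i =>
      rw [map_mul, map_one, hSi, hsq]
    | distant i j h =>
      congr 1
      rw [map_mul, map_mul, hSi, hSi, ← FusedPerm.o_mul, ← FusedPerm.o_mul]
      congr 1
      show sw i * Equiv.swap _ _ = Equiv.swap _ _ * sw i
      rw [Equiv.mul_swap_eq_swap_mul]
      congr 2
      · apply Equiv.swap_apply_of_ne_of_ne
        · intro h'; have := congrArg Fin.val h'; simp at this; omega
        · intro h'; have := congrArg Fin.val h'; simp at this; omega
      · apply Equiv.swap_apply_of_ne_of_ne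
        · intro h'; have := congrArg Fin.val h'; simp at this; omega
        · intro h'; have := congrArg Fin.val h'; simp at this; omega
    | braid i h =>
      congr 1
      simp only [map_mul, hSi, ← FusedPerm.o_mul]
      congr 1
      have h1 : sw i = Equiv.swap (⟨k + i.1, by omega⟩ : Fin (k + n)) ⟨k + i.1 + 1, by omega⟩ := rfl
      have h2 : sw ⟨i.1 + 1, h⟩ = Equiv.swap (⟨k + i.1 + 1, by omega⟩ : Fin (k + n))
        ⟨k + i.1 + 2, by omega⟩ := rfl
      rw [h1, h2]
      rw [Equiv.mul_swap_eq_swap_mul (Equiv.swap _ _) (⟨k + i.1 + 1, by omega⟩ : Fin (k + n)),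
        mul_assoc (Equiv.swap _ _) (Equiv.swap _ _) (Equiv.swap _ _), Equiv.swap_mul_self, mul_one,
        Equiv.mul_swap_eq_swap_mul (Equiv.swap _ _) (⟨k + i.1, by omega⟩ : Fin (k + n)),
        mul_assoc (Equiv.swap _ _) (Equiv.swap _ _) (Equiv.swap _ _), Equiv.swap_mul_self, mul_one,
        Equiv.swap_apply_right, Equiv.swap_apply_left]
      congr 1
      · symm
        apply Equiv.swap_apply_of_ne_of_ne
        · intro h'; have := congrArg Fin.val h'; simp at this
        · intro h'; have := congrArg Fin.val h'; simp at this
      · apply Equiv.swap_apply_of_ne_of_ne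
        · intro h'; have := congrArg Fin.val h'; simp at this
        · intro h'; have := congrArg Fin.val h'; simp at this)
  refine ⟨φ, hmul, ?_, ?_, ?_, ?_⟩
  · have := hφ 1
    rw [map_one ψ, map_one (RingQuot.mkAlgHom ℂ _), one_mul] at this
    exact this
  · intro i
    rw [hφ, hSi]
    rfl
  · rw [hφ, hX]
    exact FusedPerm.x_image ⟨k - 1, by omega⟩ kk (by show k - 1 < k; omega) hkk
  · ext a
    constructor
    · rintro ⟨q, rfl⟩
      obtain ⟨x, rfl⟩ := RingQuot.mkAlgHom_surjective ℂ _ q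
      show P * _ * P = _
      rw [hφ, hc, ← mul_assoc, hP, mul_assoc, hc, ← mul_assoc, hP]
    · intro ha
      let T := LinearMap.range φ
      have hST : ∀ s ∈ ψ.range, ∀ t ∈ T, s * t ∈ T := by
        rintro _ ⟨x, rfl⟩ _ ⟨q, rfl⟩
        obtain ⟨y, rfl⟩ := RingQuot.mkAlgHom_surjective ℂ _ q
        refine ⟨RingQuot.mkAlgHom ℂ _ (x * y), ?_⟩
        rw [hφ, hφ, map_mul, mul_assoc]
        rfl
      have hPT : P ∈ T := ⟨RingQuot.mkAlgHom ℂ _ 1, by rw [hφ, map_one, one_mul]⟩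
      have hS : ∀ g : Equiv.Perm (Fin (k + n)), (∀ x, x.1 < k → g x = x) →
          FusedPerm.o g ∈ ψ.range :=
        FusedPerm.mem_of_fix ψ.range fun i hi => ⟨S2 n ⟨i, by omega⟩, hSi _⟩
      have hLk : FusedPerm.L kk ∈ ψ.range :=
        ⟨X2 n - 1, by
          show ψ (X2 n - 1) = _
          rw [map_sub, hX, map_one]; abel⟩
      have hm := FusedPerm.mem_main ψ.range T hST hPT hS
        (fun b hb => FusedPerm.L_mem ψ.range hS kk b hkk hLk hb)
      have hall : ∀ a : MonoidAlgebra ℂ (Equiv.Perm (Fin (k + n))), P * a * P ∈ T := by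
        intro a
        induction a using MonoidAlgebra.induction_on with
        | of g => exact hm _ g rfl
        | add f g hf hg => rw [mul_add, add_mul]; exact T.add_mem hf hg
        | smul r f hf => rw [mul_smul_comm, smul_mul_assoc]; exact T.smul_mem _ hf
      have := hall a
      have ha' : P * a * P = a := ha
      rw [ha'] at this
      exact this
end
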